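/- arXiv:2302.11181 — 3 statements merged into one kernel-verified Lean document; each statement's English description precedes it below -/
import Mathlib

section
/- Every subexponential distribution is long-tailed: if Y is a nonnegative random variable with P(Y > x) > 0 for all x, and Y₁, Y₂ are independent copies of Y with lim_{x→∞} P(Y₁ + Y₂ > x)/P(Y > x) = 2, then for every y > 0, lim_{x→∞} P(Y > x + y)/P(Y > x) = 1. -/
open Filter MeasureTheory ProbabilityTheory

/-- Every subexponential distribution is long-tailed: if `Y` is a nonnegative random
variable with everywhere-positive tail and `Y₁, Y₂` are independent copies of `Y` with
`P(Y₁ + Y₂ > x)/P(Y > x) → 2`, then for every `y > 0`, `P(Y > x + y)/P(Y > x) → 1`. -/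
theorem subexponential_implies_longtailed
    {Ω : Type*} [MeasureSpace Ω] [IsProbabilityMeasure (volume : Measure Ω)]
    (Y Y₁ Y₂ : Ω → ℝ)
    (hY : Measurable Y) (hY₁ : Measurable Y₁) (hY₂ : Measurable Y₂)
    (hnn : ∀ ω, 0 ≤ Y ω)
    (hid₁ : IdentDistrib Y₁ Y) (hid₂ : IdentDistrib Y₂ Y)
    (hindep : IndepFun Y₁ Y₂)
    (hpos : ∀ x : ℝ, 0 < volume {ω | x < Y ω})
    (hsub : Tendsto
      (fun x : ℝ => (volume {ω | x < Y₁ ω + Y₂ ω}).toReal / (volume {ω | x < Y ω}).toReal)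
      atTop (nhds 2)) :
    ∀ y > 0, Tendsto
      (fun x : ℝ => (volume {ω | x + y < Y ω}).toReal / (volume {ω | x < Y ω}).toReal)
      atTop (nhds 1) := by
  intro y hy
  set G : ℝ → ℝ := fun x => (volume {ω | x < Y ω}).toReal with hG
  have hGpos : ∀ x, 0 < G x := fun x =>
    ENNReal.toReal_pos (hpos x).ne' (measure_ne_top _ _)
  have hGanti : ∀ a b, a ≤ b → G b ≤ G a := by
    intro a b hab
    refine ENNReal.toReal_mono (measure_ne_top _ _) (measure_mono ?_)
    intro ω hω
    exact lt_of_le_of_lt hab hω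
  have hG0 : Tendsto G atTop (nhds 0) := by
    haveI : IsProbabilityMeasure (Measure.map Y (volume : Measure Ω)) :=
      Measure.isProbabilityMeasure_map hY.aemeasurable
    have h1 := tendsto_cdf_atTop (Measure.map Y (volume : Measure Ω))
    have h2 : G = fun x => 1 - cdf (Measure.map Y (volume : Measure Ω)) x := by
      funext x
      rw [cdf_eq_real, map_measureReal_apply hY measurableSet_Iic,
        ← probReal_compl_eq_one_sub (hY measurableSet_Iic)]
      simp only [hG, Measure.real]
      congr 2
      ext ω
      simp
    rw [h2]
    simpa using h1.const_sub 1
  have e1 : ∀ s : Set ℝ, MeasurableSet s → volume (Y₁ ⁻¹' s) = volume (Y ⁻¹' s) :=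
    fun s hs => hid₁.measure_mem_eq hs
  have e2 : ∀ s : Set ℝ, MeasurableSet s → volume (Y₂ ⁻¹' s) = volume (Y ⁻¹' s) :=
    fun s hs => hid₂.measure_mem_eq hs
  have hempty : Y ⁻¹' (Set.Iio 0) = ∅ := by
    ext ω
    simpa using hnn ω
  have n1 : ∀ᵐ ω, 0 ≤ Y₁ ω := by
    have := e1 (Set.Iio 0) measurableSet_Iio
    rw [hempty, measure_empty] at this
    filter_upwards [measure_eq_zero_iff_ae_notMem.1 this] with ω h
    simpa using h
  have n2 : ∀ᵐ ω, 0 ≤ Y₂ ω := by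
    have := e2 (Set.Iio 0) measurableSet_Iio
    rw [hempty, measure_empty] at this
    filter_upwards [measure_eq_zero_iff_ae_notMem.1 this] with ω h
    simpa using h
  have r1 : ∀ x, (volume : Measure Ω).real (Y₁ ⁻¹' Set.Ioi x) = G x := fun x =>
    congrArg ENNReal.toReal (e1 _ measurableSet_Ioi)
  have r2 : ∀ x, (volume : Measure Ω).real (Y₂ ⁻¹' Set.Ioi x) = G x := fun x =>
    congrArg ENNReal.toReal (e2 _ measurableSet_Ioi)
  have r2c : (volume : Measure Ω).real (Y₂ ⁻¹' Set.Iic y) = 1 - G y := by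
    rw [← r2 y, ← probReal_compl_eq_one_sub (hY₂ measurableSet_Ioi), ← Set.preimage_compl,
      Set.compl_Ioi]
  have r2m : ∀ x, y ≤ x → (volume : Measure Ω).real (Y₂ ⁻¹' Set.Ioc y x) = G y - G x := by
    intro x hx
    rw [← r2 y, ← r2 x, ← measureReal_diff (Set.preimage_mono (Set.Ioi_subset_Ioi hx))
      (hY₂ measurableSet_Ioi), ← Set.preimage_diff]
    congr 2
    ext t
    simp
  have ind : ∀ s t : Set ℝ, MeasurableSet s → MeasurableSet t →
      (volume : Measure Ω).real (Y₁ ⁻¹' s ∩ Y₂ ⁻¹' t)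
        = (volume : Measure Ω).real (Y₁ ⁻¹' s) * (volume : Measure Ω).real (Y₂ ⁻¹' t) := by
    intro s t hs ht
    simp only [Measure.real]
    rw [hindep.measure_inter_preimage_eq_mul s t hs ht, ENNReal.toReal_mul]
  have key : ∀ x, y ≤ x → G x + G x * (1 - G y) + G (x - y) * (G y - G x)
      ≤ (volume {ω | x < Y₁ ω + Y₂ ω}).toReal := by
    intro x hx
    rw [← r2c, ← r2m x hx, ← r1 (x - y), ← ind _ _ measurableSet_Ioi measurableSet_Ioc]
    nth_rewrite 2 [← r1 x]
    rw [← r2 x, ← ind _ _ measurableSet_Ioi measurableSet_Iic, ← measureReal_union,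
      ← measureReal_union]
    · refine ENNReal.toReal_mono (measure_ne_top _ _) (measure_mono_ae ?_)
      filter_upwards [n1, n2] with ω h1 h2 h
      change x < Y₁ ω + Y₂ ω
      rcases h with (h | ⟨h, h'⟩) | ⟨h, h', h''⟩
      · change x < Y₂ ω at h
        linarith
      · change x < Y₁ ω at h
        linarith
      · change x - y < Y₁ ω at h
        linarith
    · rw [Set.disjoint_left]
      rintro ω (h | ⟨h, h'⟩) ⟨h3, h4, h5⟩
      · exact absurd h (not_lt.2 h5)
      · exact absurd h4 (not_lt.2 h')
    · exact (hY₁ measurableSet_Ioi).inter (hY₂ measurableSet_Ioc)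
    · rw [Set.disjoint_left]
      rintro ω h ⟨h3, h4⟩
      change x < Y₂ ω at h
      change Y₂ ω ≤ y at h4
      linarith
    · exact (hY₁ measurableSet_Ioi).inter (hY₂ measurableSet_Iic)
  have hup : Tendsto (fun x : ℝ => ((volume {ω | x < Y₁ ω + Y₂ ω}).toReal / G x - 2 + G y)
      / (G y - G x)) atTop (nhds 1) := by
    have h := ((hsub.sub_const 2).add_const (G y)).div (hG0.const_sub (G y))
      (by simpa using (hGpos y).ne')
    have h3 : (2 - 2 + G y) / (G y - 0) = 1 := by
      rw [sub_self, zero_add, sub_zero, div_self (hGpos y).ne']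
    rw [h3] at h
    exact h
  have hlim : Tendsto (fun x => G (x - y) / G x) atTop (nhds 1) := by
    refine tendsto_of_tendsto_of_tendsto_of_le_of_le' tendsto_const_nhds hup ?_ ?_
    · exact Eventually.of_forall fun x => (one_le_div (hGpos x)).2 (hGanti _ _ (by linarith))
    · filter_upwards [eventually_ge_atTop y, hG0.eventually_lt_const (hGpos y)] with x hx hlt
      have hx0 := hGpos x
      rw [le_div_iff₀ (sub_pos.2 hlt)]
      have hk := div_le_div_of_nonneg_right (key x hx) hx0.le
      have : (G x + G x * (1 - G y) + G (x - y) * (G y - G x)) / G x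
          = 2 - G y + G (x - y) / G x * (G y - G x) := by
        field_simp
        ring
      linarith
  have hs := (hlim.comp (tendsto_atTop_add_const_right atTop y tendsto_id)).inv₀ one_ne_zero
  rw [inv_one] at hs
  refine hs.congr fun x => ?_
  simp [hG]
end

section
/- Let 1 ≤ p₁ < p₂ be real numbers and let Y be a nonnegative random variable with P(Y > x) > 0 for all x. If Y is p₂th-order long-tailed, then Y is p₁th-order long-tailed. In particular, every pth-order long-tailed random variable with p > 1 is long-tailed. -/
open Filter MeasureTheory

/-- If `1 ≤ p₁ < p₂` and the nonnegative random variable `Y` (with everywhere-positive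
tail) is `p₂`-th-order long-tailed (i.e. `Y^{1/p₂}` is long-tailed), then `Y` is
`p₁`-th-order long-tailed (i.e. `Y^{1/p₁}` is long-tailed). -/
theorem high_order_longtailed_mono
    {Ω : Type*} [MeasureSpace Ω] [IsProbabilityMeasure (volume : Measure Ω)]
    (Y : Ω → ℝ) (hY : Measurable Y) (hnn : ∀ ω, 0 ≤ Y ω)
    (p₁ p₂ : ℝ) (hp₁ : 1 ≤ p₁) (hp₁₂ : p₁ < p₂)
    (hpos : ∀ x : ℝ, 0 < volume {ω | x < Y ω})
    (h : ∀ y > 0, Tendsto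
      (fun x : ℝ => (volume {ω | x + y < Y ω ^ (1 / p₂)}).toReal
        / (volume {ω | x < Y ω ^ (1 / p₂)}).toReal) atTop (nhds 1)) :
    ∀ y > 0, Tendsto
      (fun x : ℝ => (volume {ω | x + y < Y ω ^ (1 / p₁)}).toReal
        / (volume {ω | x < Y ω ^ (1 / p₁)}).toReal) atTop (nhds 1) := by
  intro y hy
  have hp₁0 : 0 < p₁ := by linarith
  have hp₂0 : 0 < p₂ := by linarith
  have hr0 : 0 < p₁ / p₂ := by positivity
  have hr1 : p₁ / p₂ ≤ 1 := by rw [div_le_one hp₂0]; exact hp₁₂.le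
  have key : ∀ x : ℝ, 0 ≤ x → {ω | x < Y ω ^ (1 / p₁)} =
      {ω | x ^ (p₁ / p₂) < Y ω ^ (1 / p₂)} := by
    intro x hx
    ext ω
    have e : Y ω ^ (1 / p₂) = (Y ω ^ (1 / p₁)) ^ (p₁ / p₂) := by
      rw [← Real.rpow_mul (hnn ω)]
      congr 1
      field_simp
    simp only [Set.mem_setOf_eq]
    rw [e, Real.rpow_lt_rpow_iff hx (Real.rpow_nonneg (hnn ω) _) hr0]
  have h1 := (h (y ^ (p₁ / p₂)) (Real.rpow_pos_of_pos hy _)).comp (tendsto_rpow_atTop hr0)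
  refine tendsto_of_tendsto_of_tendsto_of_le_of_le' h1 tendsto_const_nhds ?_ ?_
  · filter_upwards [eventually_ge_atTop 0] with x hx
    simp only [Function.comp]
    rw [key x hx, key (x + y) (by linarith)]
    refine div_le_div_of_nonneg_right ?_ ENNReal.toReal_nonneg
    refine ENNReal.toReal_mono (measure_ne_top _ _) (measure_mono ?_)
    intro ω hω
    exact lt_of_le_of_lt (Real.rpow_add_le_add_rpow hx hy.le hr0.le hr1) hω
  · filter_upwards with x
    refine div_le_one_of_le₀ ?_ ENNReal.toReal_nonneg
    refine ENNReal.toReal_mono (measure_ne_top _ _) (measure_mono ?_)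
    intro ω hω
    simp only [Set.mem_setOf_eq] at hω ⊢
    linarith
end

section
/- Let p ≥ 1 and let F̄ : [0,∞) → (0,1] be a nonincreasing integrable function satisfying lim_{x→∞} F̄(x - x^{1-1/p})/F̄(x) = 1. Then the integrated tail also satisfies lim_{x→∞} (∫_{x - x^{1-1/p}}^∞ F̄(t) dt) / (∫_x^∞ F̄(t) dt) = 1. Consequently, if a distribution F on [0,∞) with finite positive mean is pth-order long-tailed, then its integrated tail distribution F_I is also pth-order long-tailed. -/
open Filter MeasureTheory Set

/-- If `F̄ : [0,∞) → (0,1]` is nonincreasing, integrable, and satisfies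
`F̄(x - x^{1-1/p})/F̄(x) → 1` (i.e. `F̄` is `p`th-order long-tailed), then the
integrated tail satisfies
`(∫_{x - x^{1-1/p}}^∞ F̄(t) dt) / (∫_x^∞ F̄(t) dt) → 1`; consequently the integrated
tail distribution `F_I` is also `p`th-order long-tailed. -/
theorem integrated_tail_high_order_longtailed
    (p : ℝ) (hp : 1 ≤ p) (F : ℝ → ℝ)
    (hrange : ∀ x : ℝ, 0 ≤ x → 0 < F x ∧ F x ≤ 1)
    (hanti : AntitoneOn F (Set.Ici 0))
    (hint : IntegrableOn F (Set.Ici 0))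
    (h : Tendsto (fun x : ℝ => F (x - x ^ (1 - 1 / p)) / F x) atTop (nhds 1)) :
    Tendsto
      (fun x : ℝ => (∫ t in Set.Ioi (x - x ^ (1 - 1 / p)), F t) / ∫ t in Set.Ioi x, F t)
      atTop (nhds 1) := by
  have ha : 0 ≤ 1 - 1 / p := by
    have : 1 / p ≤ 1 := by
      rw [div_le_one (by linarith)]
      exact hp
    linarith
  have ha1 : 1 - 1 / p ≤ 1 := by
    have : 0 < 1 / p := by positivity
    linarith
  generalize 1 - 1 / p = a at *
  have hphi : ∀ x : ℝ, 1 ≤ x → 0 ≤ x - x ^ a := by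
    intro x hx
    have := Real.rpow_le_rpow_of_exponent_le hx ha1
    rw [Real.rpow_one] at this
    linarith
  have hintx : ∀ y : ℝ, 0 ≤ y → IntegrableOn F (Ioi y) := fun y hy =>
    hint.mono_set (fun z hz => hy.trans (le_of_lt hz))
  have hpos : ∀ y : ℝ, 0 ≤ y → 0 < ∫ t in Ioi y, F t := by
    intro y hy
    rw [setIntegral_pos_iff_support_of_nonneg_ae _ (hintx y hy)]
    · have : Function.support F ∩ Ioi y = Ioi y := by
        apply inter_eq_right.mpr
        intro z hz
        exact (hrange z (hy.trans (le_of_lt hz))).1.ne'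
      rw [this]
      simp
    · filter_upwards [ae_restrict_mem measurableSet_Ioi] with z hz
      exact (hrange z (hy.trans (le_of_lt hz))).1.le
  have hshift : ∀ y c : ℝ, (∫ t in Ioi y, F (t + c)) = ∫ t in Ioi (y + c), F t := by
    intro y c
    have := (measurePreserving_add_right (volume : Measure ℝ) c).setIntegral_preimage_emb
      (MeasurableEquiv.addRight c).measurableEmbedding F (Ioi (y + c))
    simpa using this
  have hshiftI : ∀ y c : ℝ, 0 ≤ y + c → IntegrableOn (fun t => F (t + c)) (Ioi y) := by
    intro y c hy
    have := ((measurePreserving_add_right (volume : Measure ℝ) c).integrableOn_comp_preimage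
      (MeasurableEquiv.addRight c).measurableEmbedding (f := F) (s := Ioi (y + c))).mpr
      (hintx _ hy)
    simpa [Function.comp_def] using this
  rw [Metric.tendsto_atTop]
  intro ε hε
  obtain ⟨N, hN⟩ := (Metric.tendsto_atTop.mp h) (ε / 2) (by linarith)
  refine ⟨max N 1, fun x hx => ?_⟩
  have hxN : N ≤ x := (le_max_left _ _).trans hx
  have hx1 : 1 ≤ x := (le_max_right _ _).trans hx
  have hG := hpos x (by linarith)
  have hc : 0 ≤ x ^ a := Real.rpow_nonneg (by linarith) a
  have hy := hphi x hx1
  have hpt : ∀ t ∈ Ioi (x - x ^ a), F t ≤ (1 + ε / 2) * F (t + x ^ a) := by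
    intro t ht
    have ht' : x - x ^ a < t := ht
    have hs : x ≤ t + x ^ a := by linarith
    have h1 := hN (t + x ^ a) (hxN.trans hs)
    rw [Real.dist_eq, abs_lt] at h1
    have hF := (hrange (t + x ^ a) (by linarith)).1
    have h2 : F (t + x ^ a - (t + x ^ a) ^ a) ≤ (1 + ε / 2) * F (t + x ^ a) := by
      rw [← div_le_iff₀ hF]
      linarith [h1.2]
    have h3 : x ^ a ≤ (t + x ^ a) ^ a := Real.rpow_le_rpow (by linarith) hs ha
    have h4 := hphi (t + x ^ a) (by linarith)
    refine le_trans (hanti (mem_Ici.mpr h4) (mem_Ici.mpr (by linarith)) (by linarith)) h2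
  have hup : (∫ t in Ioi (x - x ^ a), F t) ≤ (1 + ε / 2) * ∫ t in Ioi x, F t := by
    have h1 := setIntegral_mono_on (hintx _ hy)
      ((hshiftI (x - x ^ a) (x ^ a) (by linarith)).const_mul (1 + ε / 2)) measurableSet_Ioi hpt
    rw [integral_const_mul, hshift, sub_add_cancel] at h1
    exact h1
  have hlow : (∫ t in Ioi x, F t) ≤ ∫ t in Ioi (x - x ^ a), F t := by
    apply setIntegral_mono_set (hintx _ hy)
    · filter_upwards [ae_restrict_mem measurableSet_Ioi] with z hz
      exact (hrange z (hy.trans (le_of_lt hz))).1.le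
    · exact (Ioi_subset_Ioi (by linarith)).eventuallyLE
  have e1 := (div_le_iff₀ hG).mpr hup
  have e2 := (one_le_div hG).mpr hlow
  rw [Real.dist_eq, abs_lt]
  constructor <;> linarith
end
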